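/- arXiv:2509.21915 — 2 statements merged into one kernel-verified Lean document; each statement's English description precedes it below -/
import Mathlib

section
/- Let w ∈ W satisfy w·{α_k : k ∈ K} = {α_j : j ∈ J} as sets of simple roots, and suppose (x,I) ∈ Cham(J) and w ∈ Hom_BH(I,K) (i.e., {α_i : i ∈ I} = {w·α_k : k ∈ K}). Then (xw, K) ∈ Cham(J): that is, W_J(xw) = (xw)W_K and xw has minimal length in the coset xw·W_K. -/
open CoxeterSystem

/-- `v` is a nonnegative linear combination of the vectors `α b`. -/
def InNonnegSpan {B V : Type*} [AddCommGroup V] [Module ℝ V] (α : B → V) (v : V) : Prop :=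
  ∃ c : B →₀ ℝ, (∀ b, 0 ≤ c b) ∧ v = c.sum fun b r => r • α b

/-- The reflection representation of a Coxeter system, axiomatised: a representation `ρ` of `W`
on a real vector space `V` with linearly independent simple roots `α i` spanning `V`, such that
each simple reflection negates its simple root, every root `w · α i` is positive or negative,
and positivity of `w · α i` is detected by the length function. -/
structure ReflRep {B W : Type*} [Group W] {M : CoxeterMatrix B} (cs : CoxeterSystem M W)
    (V : Type*) [AddCommGroup V] [Module ℝ V] where
  ρ : Representation ℝ W V
  α : B → V
  indep : LinearIndependent ℝ α
  spans : Submodule.span ℝ (Set.range α) = ⊤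
  refl_simple : ∀ i : B, ρ (cs.simple i) (α i) = -α i
  root_pos_or_neg : ∀ (w : W) (i : B),
    InNonnegSpan α (ρ w (α i)) ∨ InNonnegSpan α (-(ρ w (α i)))
  pos_iff_length : ∀ (w : W) (i : B),
    InNonnegSpan α (ρ w (α i)) ↔ cs.length (w * cs.simple i) = cs.length w + 1

/-- The standard parabolic subgroup `W_J`. -/
def parabolic {B W : Type*} [Group W] {M : CoxeterMatrix B} (cs : CoxeterSystem M W)
    (J : Set B) : Subgroup W :=
  Subgroup.closure (cs.simple '' J)

/-- `(x, I)` is a chamber label in `Cham(J)`. -/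
def IsChamberLabel {B W : Type*} [Group W] {M : CoxeterMatrix B} (cs : CoxeterSystem M W)
    (J : Set B) (x : W) (I : Set B) : Prop :=
  ((· * x) '' (parabolic cs J : Set W) = (x * ·) '' (parabolic cs I : Set W)) ∧
  ∀ v ∈ parabolic cs I, cs.length x ≤ cs.length (x * v)

section Aux
open Classical

variable {B W : Type*} [Group W] {M : CoxeterMatrix B} (cs : CoxeterSystem M W)

/-- Bourbaki's sign permutation attached to a simple reflection. -/
noncomputable def sgnAct (i : B) : Function.End (W × ZMod 2) :=
  fun p => (cs.simple i * p.1 * (cs.simple i)⁻¹, p.2 + if p.1 = cs.simple i then 1 else 0)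

theorem sgnAct_pow (i j : B) (n : ℕ) (t : W) (e : ZMod 2) :
    ((sgnAct cs i * sgnAct cs j) ^ n) (t, e) =
      ((cs.simple i * cs.simple j) ^ n * t * ((cs.simple i * cs.simple j) ^ n)⁻¹,
        e + ∑ l ∈ Finset.range (2 * n),
          if t = ((cs.simple i * cs.simple j) ^ l)⁻¹ * cs.simple j then 1 else 0) := by
  induction n with
  | zero => simp; rfl
  | succ n ih =>
    have hcomm : ∀ n : ℕ, cs.simple j * (cs.simple i * cs.simple j) ^ n
        = ((cs.simple i * cs.simple j) ^ n)⁻¹ * cs.simple j := by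
      intro n
      induction n with
      | zero => simp
      | succ n ih =>
        rw [pow_succ, ← mul_assoc, ih, ← pow_succ, pow_succ']
        simp [mul_assoc]
    rw [pow_succ']
    change sgnAct cs i (sgnAct cs j (((sgnAct cs i * sgnAct cs j) ^ n) (t, e))) = _
    rw [ih]
    unfold sgnAct
    set c := cs.simple i * cs.simple j with hc
    have h1 : (c ^ n * t * (c ^ n)⁻¹ = cs.simple j) ↔ t = (c ^ (2 * n))⁻¹ * cs.simple j := by
      rw [two_mul, pow_add, mul_inv_rev, mul_assoc (c ^ n)⁻¹ (c ^ n)⁻¹, ← hcomm n]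
      constructor
      · intro h
        rw [← h]; group
      · intro h
        rw [h]; group
    have h2 : (cs.simple j * (c ^ n * t * (c ^ n)⁻¹) * (cs.simple j)⁻¹ = cs.simple i) ↔
        t = (c ^ (2 * n + 1))⁻¹ * cs.simple j := by
      have : (c ^ (2 * n + 1))⁻¹ * cs.simple j
          = (c ^ n)⁻¹ * ((cs.simple j)⁻¹ * cs.simple i * cs.simple j) * c ^ n := by
        rw [show 2 * n + 1 = (n + 1) + n by ring, pow_add, mul_inv_rev, mul_assoc, ← hcomm (n+1),
          pow_succ', hc]
        simp [mul_assoc]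
      rw [this]
      constructor
      · intro h
        rw [← h]; group
      · intro h
        rw [h]; group
    simp only [h1, h2, Prod.mk.injEq]
    constructor
    · rw [pow_succ', mul_inv_rev, hc, mul_inv_rev]; simp only [mul_assoc]
    · rw [show 2 * (n + 1) = 2 * n + 1 + 1 by ring, Finset.sum_range_succ, Finset.sum_range_succ]
      ring

theorem sgnAct_liftable : M.IsLiftable (sgnAct cs) := by
  intro i j
  funext ⟨t, e⟩
  rw [sgnAct_pow]
  have h := cs.simple_mul_simple_pow i j
  rw [h, two_mul, Finset.sum_range_add]
  simp only [pow_add, h, one_mul, CharTwo.add_self_eq_zero]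
  simp
  rfl

/-- The sign cocycle. -/
noncomputable def sgnHom : W →* Function.End (W × ZMod 2) :=
  cs.lift ⟨sgnAct cs, sgnAct_liftable cs⟩

theorem sgnHom_wordProd (ω : List B) (t : W) (e : ZMod 2) :
    sgnHom cs (cs.wordProd ω) (t, e) =
      (cs.wordProd ω * t * (cs.wordProd ω)⁻¹, e + ((cs.rightInvSeq ω).count t : ZMod 2)) := by
  induction ω with
  | nil => simp [rightInvSeq]; rfl
  | cons i ω ih =>
    rw [wordProd_cons, map_mul]
    change sgnHom cs (cs.simple i) (sgnHom cs (cs.wordProd ω) (t, e)) = _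
    rw [ih]
    have : sgnHom cs (cs.simple i) = sgnAct cs i := cs.lift_apply_simple _ _
    rw [this]
    unfold sgnAct
    have h1 : (cs.wordProd ω * t * (cs.wordProd ω)⁻¹ = cs.simple i) ↔
        (cs.wordProd ω)⁻¹ * cs.simple i * cs.wordProd ω = t := by
      constructor
      · intro h
        rw [← h]; group
      · intro h
        rw [← h]; group
    simp only [h1, rightInvSeq, List.count_cons, Prod.mk.injEq]
    constructor
    · group
    · by_cases h : (cs.wordProd ω)⁻¹ * cs.simple i * cs.wordProd ω = t <;> simp [h, add_assoc]

/-- Parity of the number of times `t` occurs as a right inversion. -/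
noncomputable def eta (w t : W) : ZMod 2 := (sgnHom cs w (t, 0)).2

theorem sgnHom_apply (w t : W) (e : ZMod 2) :
    sgnHom cs w (t, e) = (w * t * w⁻¹, e + eta cs w t) := by
  obtain ⟨ω, rfl⟩ := cs.wordProd_surjective w
  simp [eta, sgnHom_wordProd]

theorem eta_wordProd (ω : List B) (t : W) :
    eta cs (cs.wordProd ω) t = ((cs.rightInvSeq ω).count t : ZMod 2) := by
  simp [eta, sgnHom_wordProd]

theorem eta_mul (w u t : W) : eta cs (w * u) t = eta cs u t + eta cs w (u * t * u⁻¹) := by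
  have : sgnHom cs (w * u) (t, 0) = sgnHom cs w (sgnHom cs u (t, 0)) := by
    rw [map_mul]; rfl
  rw [sgnHom_apply, sgnHom_apply, sgnHom_apply] at this
  simpa using congrArg Prod.snd this

theorem eta_simple (i : B) (t : W) :
    eta cs (cs.simple i) t = if t = cs.simple i then 1 else 0 := by
  have : sgnHom cs (cs.simple i) = sgnAct cs i := cs.lift_apply_simple _ _
  simp [eta, this, sgnAct]

theorem mem_of_eta_ne {ω : List B} {t : W} (h : eta cs (cs.wordProd ω) t ≠ 0) :
    t ∈ cs.rightInvSeq ω := by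
  rw [eta_wordProd] at h
  by_contra hn
  rw [List.count_eq_zero_of_not_mem hn] at h
  simp at h

theorem length_lt_of_eta_ne {w t : W} (h : eta cs w t ≠ 0) :
    cs.length (w * t) < cs.length w := by
  obtain ⟨ω, hω, rfl⟩ := cs.exists_isReduced w
  exact (cs.isRightInversion_of_mem_rightInvSeq hω (mem_of_eta_ne cs h)).2

theorem eta_mul_simple (w : W) (k : B) :
    eta cs (w * cs.simple k) (cs.simple k) = 1 + eta cs w (cs.simple k) := by
  rw [eta_mul, eta_simple]; simp

theorem eta_ne_of_length_lt {w : W} {k : B} (h : cs.length (w * cs.simple k) < cs.length w) :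
    eta cs w (cs.simple k) ≠ 0 := by
  intro h0
  have h1 := eta_mul_simple cs w k
  rw [h0, add_zero] at h1
  have := length_lt_of_eta_ne cs (w := w * cs.simple k) (t := cs.simple k) (by rw [h1]; simp)
  simp at this
  omega

theorem conj_eq_of_length {w : W} {i k : B}
    (h1 : cs.length w ≤ cs.length (w * cs.simple k))
    (h2 : cs.length (cs.simple i * w * cs.simple k) < cs.length (cs.simple i * w)) :
    w * cs.simple k * w⁻¹ = cs.simple i := by
  have e1 : eta cs w (cs.simple k) = 0 := by
    by_contra h
    have := length_lt_of_eta_ne cs h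
    omega
  have e2 := eta_ne_of_length_lt cs h2
  rw [eta_mul, e1, eta_simple] at e2
  by_contra h
  simp [h] at e2

theorem exists_word_of_mem_parabolic {K : Set B} {u : W} (hu : u ∈ parabolic cs K) :
    ∃ ω : List B, (∀ k ∈ ω, k ∈ K) ∧ cs.wordProd ω = u := by
  unfold parabolic at hu
  induction hu using Subgroup.closure_induction with
  | mem x hx =>
    obtain ⟨k, hk, rfl⟩ := hx
    exact ⟨[k], by simpa using hk, by simp⟩
  | one => exact ⟨[], by simp, by simp⟩
  | mul x y _ _ hx hy =>
    obtain ⟨a, ha, rfl⟩ := hx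
    obtain ⟨b, hb, rfl⟩ := hy
    refine ⟨a ++ b, ?_, cs.wordProd_append _ _⟩
    intro k hk
    rcases List.mem_append.1 hk with h | h
    · exact ha k h
    · exact hb k h
  | inv x _ hx =>
    obtain ⟨a, ha, rfl⟩ := hx
    exact ⟨a.reverse, by simpa using ha, by simp⟩

theorem eq_one_of_eta {K : Set B} {u : W} (hu : u ∈ parabolic cs K)
    (h : ∀ k ∈ K, eta cs u (cs.simple k) = 0) : u = 1 := by
  have hex : ∃ n, ∃ ω : List B, ω.length = n ∧ (∀ k ∈ ω, k ∈ K) ∧ cs.wordProd ω = u := by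
    obtain ⟨ω, h1, h2⟩ := exists_word_of_mem_parabolic cs hu
    exact ⟨_, ω, rfl, h1, h2⟩
  obtain ⟨ω, hl, hK, hp⟩ := Nat.find_spec hex
  have hmin := fun m => Nat.find_min' hex (m := m)
  rw [← hl] at hmin
  rcases List.eq_nil_or_concat ω with rfl | ⟨ω', k, rfl⟩
  · simpa using hp.symm
  · exfalso
    simp only [List.concat_eq_append] at hK hp hmin
    have hk : k ∈ K := hK k (by simp)
    have hp' : cs.wordProd ω' * cs.simple k = u := by
      rw [← hp, wordProd_append]; simp
    have h0 := h k hk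
    rw [← hp', eta_mul_simple] at h0
    have hm : cs.simple k ∈ cs.rightInvSeq ω' := by
      apply mem_of_eta_ne
      intro h'
      rw [h'] at h0
      simp at h0
    obtain ⟨j, hj, hje⟩ := List.getElem_of_mem hm
    have h3 := cs.wordProd_mul_getD_rightInvSeq ω' j
    rw [List.getD_eq_getElem _ _ hj, hje, hp'] at h3
    have h4 := hmin _ ⟨ω'.eraseIdx j, rfl, fun k' hk' =>
      hK k' (List.mem_append_left _ (List.mem_of_mem_eraseIdx hk')), h3.symm⟩
    have h5 := List.length_eraseIdx_le ω' j
    simp at h4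
    omega

theorem length_min_of_simple {K : Set B} {z : W}
    (h : ∀ k ∈ K, cs.length z ≤ cs.length (z * cs.simple k)) (v : W) (hv : v ∈ parabolic cs K) :
    cs.length z ≤ cs.length (z * v) := by
  have hex : ∃ n, ∃ u ∈ parabolic cs K, cs.length (z * u) = n :=
    ⟨_, 1, one_mem _, rfl⟩
  obtain ⟨u, hu, hl⟩ := Nat.find_spec hex
  have hmin := fun m => Nat.find_min' hex (m := m)
  rw [← hl] at hmin
  have hu1 : u⁻¹ = 1 := by
    apply eq_one_of_eta cs (inv_mem hu)
    intro k hk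
    have hz : eta cs z (cs.simple k) = 0 := by
      by_contra hne
      have := length_lt_of_eta_ne cs hne
      have := h k hk
      omega
    have hkK : cs.simple k ∈ parabolic cs K := Subgroup.subset_closure ⟨k, hk, rfl⟩
    have e := eta_mul cs (z * u) u⁻¹ (cs.simple k)
    rw [mul_inv_cancel_right, hz] at e
    have : eta cs (z * u) (u⁻¹ * cs.simple k * u⁻¹⁻¹) = 0 := by
      by_contra hne
      have h1 := length_lt_of_eta_ne cs hne
      have h2 := hmin _ ⟨u * (u⁻¹ * cs.simple k * u⁻¹⁻¹),
        mul_mem hu (mul_mem (mul_mem (inv_mem hu) hkK) (by simpa using hu)), rfl⟩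
      rw [← mul_assoc] at h2
      omega
    rw [this, add_zero] at e
    exact e.symm
  have hu2 : u = 1 := by simpa using hu1
  subst hu2
  simpa using hmin _ ⟨v, hv, rfl⟩

theorem inNonnegSpan_simple {V : Type*} [AddCommGroup V] [Module ℝ V] (α : B → V) (i : B) :
    InNonnegSpan α (α i) := by
  refine ⟨Finsupp.single i 1, fun b => ?_, by simp⟩
  rw [Finsupp.single_apply]; split_ifs <;> norm_num

theorem not_inNonnegSpan_neg {V : Type*} [AddCommGroup V] [Module ℝ V] (r : ReflRep cs V) (i : B) :
    ¬ InNonnegSpan r.α (-(r.α i)) := by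
  have h := (r.pos_iff_length (cs.simple i) i).not
  rw [r.refl_simple] at h
  rw [h]; simp

theorem simple_conj_of_root {V : Type*} [AddCommGroup V] [Module ℝ V] (r : ReflRep cs V)
    {w : W} {i k : B} (h : r.ρ w (r.α k) = r.α i) : w * cs.simple k * w⁻¹ = cs.simple i := by
  apply conj_eq_of_length
  · have := (r.pos_iff_length w k).1 (h ▸ inNonnegSpan_simple r.α i)
    omega
  · have h1 : r.ρ (cs.simple i * w) (r.α k) = - r.α i := by
      rw [map_mul, Module.End.mul_apply, h, r.refl_simple]
    have h2 := (r.pos_iff_length (cs.simple i * w) k).not.1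
      (h1 ▸ not_inNonnegSpan_neg cs r i)
    rcases cs.length_mul_simple (cs.simple i * w) k with h3 | h3
    · exact absurd h3 h2
    · omega

end Aux

/-- If `(x,I) ∈ Cham(J)` and `w ∈ Hom_BH(I,K)`, i.e.
`{α_i : i ∈ I} = w · {α_k : k ∈ K}`, then `(xw, K) ∈ Cham(J)`: `W_J (xw) = (xw) W_K` and `xw` has
minimal length in `xw W_K`. -/
theorem chamber_label_mul_BH_morphism {B W V : Type*} [Group W]
    [AddCommGroup V] [Module ℝ V] {M : CoxeterMatrix B} (cs : CoxeterSystem M W)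
    (r : ReflRep cs V) (J : Set B) (x : W) (I K : Set B) (w : W)
    (hx : IsChamberLabel cs J x I)
    (hw : r.α '' I = (r.ρ w) '' (r.α '' K)) :
    IsChamberLabel cs J (x * w) K := by
  obtain ⟨hx1, hx2⟩ := hx
  have hKI : ∀ k ∈ K, ∃ i ∈ I, r.ρ w (r.α k) = r.α i := by
    intro k hk
    have : r.ρ w (r.α k) ∈ r.α '' I := hw ▸ ⟨_, ⟨k, hk, rfl⟩, rfl⟩
    obtain ⟨i, hi, h⟩ := this
    exact ⟨i, hi, h.symm⟩
  have hIK : ∀ i ∈ I, ∃ k ∈ K, r.ρ w (r.α k) = r.α i := by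
    intro i hi
    have : r.α i ∈ (r.ρ w) '' (r.α '' K) := hw ▸ ⟨i, hi, rfl⟩
    obtain ⟨_, ⟨k, hk, rfl⟩, h⟩ := this
    exact ⟨k, hk, h⟩
  have hconj : (parabolic cs K).map (MulAut.conj w).toMonoidHom = parabolic cs I := by
    unfold parabolic
    rw [MonoidHom.map_closure]
    congr 1
    ext g
    constructor
    · rintro ⟨_, ⟨k, hk, rfl⟩, rfl⟩
      obtain ⟨i, hi, h⟩ := hKI k hk
      exact ⟨i, hi, (simple_conj_of_root cs r h).symm⟩
    · rintro ⟨i, hi, rfl⟩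
      obtain ⟨k, hk, h⟩ := hIK i hi
      exact ⟨_, ⟨k, hk, rfl⟩, simple_conj_of_root cs r h⟩
  refine ⟨?_, ?_⟩
  · have e1 : ((· * (x * w)) '' (parabolic cs J : Set W))
        = (· * w) '' ((· * x) '' (parabolic cs J : Set W)) := by
      rw [Set.image_image]; simp only [mul_assoc]
    rw [e1, hx1, Set.image_image, ← hconj]
    simp only [Subgroup.coe_map, Set.image_image]
    congr 1
    funext g
    simp [mul_assoc]
  · apply length_min_of_simple
    intro k hk
    obtain ⟨i, hi, h⟩ := hKI k hk
    have hxi := hx2 (cs.simple i) (Subgroup.subset_closure ⟨i, hi, rfl⟩)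
    have hpos : InNonnegSpan r.α (r.ρ x (r.α i)) := by
      rw [r.pos_iff_length]
      rcases cs.length_mul_simple x i with h3 | h3 <;> omega
    have : InNonnegSpan r.α (r.ρ (x * w) (r.α k)) := by
      rw [map_mul, Module.End.mul_apply, h]; exact hpos
    have := (r.pos_iff_length (x * w) k).1 this
    omega
end

section
/- Any two standard expressions of the same element of W based at the same associate have the same length: if v_{a_1,I_1} v_{a_2,I_2} ⋯ v_{a_m,I_m} = v_{b_1,L_1} v_{b_2,L_2} ⋯ v_{b_n,L_n} in W, where both products are length-additive (ℓ of the product equals the sum of the ℓ(v_{a_i,I_i}), resp. ℓ(v_{b_j,L_j})), I_1 = L_1, and each factor is a Brink–Howlett generator v_{a,I} = w_{[I,a]−a} w_{[I,a]} with consecutive targets matching sources, then m = n. -/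
open CoxeterSystem

/-- Vertices in the same connected component as `a` of the Coxeter diagram induced on `S`
(edges join `i, j` with `M i j ≠ 2`). -/
def inComponent {B : Type*} (M : CoxeterMatrix B) (S : Set B) (a b : B) : Prop :=
  Relation.ReflTransGen (fun i j => i ∈ S ∧ j ∈ S ∧ M i j ≠ 2) a b

/-- `[I,a]`: the vertex set of the connected component of the induced subdiagram on `I ∪ {a}`
containing `a`. -/
def compOf {B : Type*} (M : CoxeterMatrix B) (I : Set B) (a : B) : Set B :=
  {b | inComponent M (insert a I) a b}

/-- `I` and `J` are associates: `W_I` and `W_J` are conjugate in `W`. -/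
def IsAssociate {B W : Type*} [Group W] {M : CoxeterMatrix B} (cs : CoxeterSystem M W)
    (J I : Set B) : Prop :=
  ∃ x : W, Subgroup.map (MulAut.conj x).toMonoidHom (parabolic cs I) = parabolic cs J

namespace BH

noncomputable def kap {B : Type*} (M : CoxeterMatrix B) (i j : B) : ℝ := 2 * Real.cos (Real.pi / M i j)

noncomputable def phi {B : Type*} (M : CoxeterMatrix B) (i : B) : (B →₀ ℝ) →ₗ[ℝ] ℝ :=
  Finsupp.linearCombination ℝ (fun j => kap M i j)

/-- simple reflection of the geometric representation -/
noncomputable def sr {B : Type*} (M : CoxeterMatrix B) (i : B) : Module.End ℝ (B →₀ ℝ) :=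
  LinearMap.id + (phi M i).smulRight (Finsupp.single i 1)

variable {B : Type*} (M : CoxeterMatrix B)

theorem kap_self (i : B) : kap M i i = -2 := by simp [kap]

theorem kap_comm (i j : B) : kap M i j = kap M j i := by simp [kap, M.symmetric i j]

theorem sr_apply (i : B) (v : B →₀ ℝ) : sr M i v = v + phi M i v • Finsupp.single i 1 := by
  simp [sr]

theorem phi_single (i j : B) : phi M i (Finsupp.single j 1) = kap M i j := by
  simp [phi]

theorem sr_self (i : B) : sr M i (Finsupp.single i 1) = - Finsupp.single i 1 := by
  rw [sr_apply, phi_single, kap_self]; module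

theorem sr_sq (i : B) : sr M i * sr M i = 1 := by
  apply LinearMap.ext
  intro v
  rw [Module.End.mul_apply, sr_apply M i v, map_add, map_smul, sr_self, sr_apply, Module.End.one_apply]
  module

noncomputable def cc (k : ℝ) : ℕ → ℝ
  | 0 => 0
  | 1 => 1
  | (n+2) => k * cc k (n+1) - cc k n

theorem cc_sin (θ : ℝ) (n : ℕ) : cc (2 * Real.cos θ) n * Real.sin θ = Real.sin (n * θ) := by
  induction n using Nat.twoStepInduction with
  | zero => simp [cc]
  | one => simp [cc]
  | more n h1 h2 =>
    rw [cc, sub_mul, mul_assoc, h1, h2]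
    have : ((n + 2 : ℕ) : ℝ) * θ = ((n + 1 : ℕ) : ℝ) * θ + θ := by push_cast; ring
    have h' : (n : ℝ) * θ = ((n + 1 : ℕ) : ℝ) * θ - θ := by push_cast; ring
    rw [this, h', Real.sin_add, Real.sin_sub]; ring

theorem cc_two (n : ℕ) : cc 2 n = n := by
  induction n using Nat.twoStepInduction with
  | zero => simp [cc]
  | one => simp [cc]
  | more n h1 h2 => rw [cc, h1, h2]; push_cast; ring

theorem cc_nonneg (i j : B) (hij : i ≠ j) (n : ℕ) (h : M i j ≠ 0 → n ≤ M i j) :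
    0 ≤ cc (kap M i j) n := by
  by_cases h0 : M i j = 0
  · have : kap M i j = 2 := by simp [kap, h0]
    rw [this, cc_two]; positivity
  · have hn := h h0
    have h1 : M i j ≠ 1 := M.off_diagonal i j hij
    have h2 : (2 : ℝ) ≤ M i j := by exact_mod_cast (by omega : 2 ≤ M i j)
    have hs : 0 < Real.sin (Real.pi / M i j) := by
      apply Real.sin_pos_of_pos_of_lt_pi (by positivity)
      rw [div_lt_iff₀ (by positivity)]
      nlinarith [Real.pi_pos]
    have hc := cc_sin (Real.pi / M i j) n
    have : 0 ≤ Real.sin (n * (Real.pi / M i j)) := by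
      apply Real.sin_nonneg_of_nonneg_of_le_pi (by positivity)
      rw [← mul_div_assoc, div_le_iff₀ (by positivity)]
      have : (n : ℝ) ≤ M i j := by exact_mod_cast hn
      nlinarith [Real.pi_pos]
    rw [← hc] at this
    exact nonneg_of_mul_nonneg_left this hs

theorem pow_s (i j : B) (n : ℕ) :
    ((sr M i * sr M j) ^ n) (Finsupp.single i 1) =
      cc (kap M i j) (2*n+1) • Finsupp.single i 1 + cc (kap M i j) (2*n) • Finsupp.single j 1 := by
  induction n with
  | zero => simp [cc]
  | succ n ih =>
    rw [pow_succ', Module.End.mul_apply, ih, Module.End.mul_apply]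
    have e1 : 2 * (n+1) + 1 = 2 * n + 1 + 2 := by ring
    have e2 : 2 * (n+1) = 2 * n + 2 := by ring
    rw [e1, e2, cc, cc]
    simp only [map_add, map_smul, sr_apply, phi_single, kap_self, kap_comm M j i]
    module

theorem pow_t (i j : B) (n : ℕ) :
    ((sr M i * sr M j) ^ (n+1)) (Finsupp.single j 1) =
      -(cc (kap M i j) (2*n+2) • Finsupp.single i 1 + cc (kap M i j) (2*n+1) • Finsupp.single j 1) := by
  induction n with
  | zero =>
    simp only [zero_add, pow_one, Module.End.mul_apply, map_add, map_smul, sr_apply, phi_single, kap_self, cc]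
    module
  | succ n ih =>
    rw [pow_succ', Module.End.mul_apply, ih, Module.End.mul_apply]
    have e1 : 2 * (n+1) + 1 = 2 * n + 1 + 2 := by ring
    have e2 : 2 * (n+1) + 2 = 2 * n + 2 + 2 := by ring
    have f1 : cc (kap M i j) (2 * n + 2 + 2) = kap M i j * (kap M i j * cc (kap M i j) (2 * n + 2)
      - cc (kap M i j) (2 * n + 1)) - cc (kap M i j) (2 * n + 2) := rfl
    have f2 : cc (kap M i j) (2 * n + 1 + 2) = kap M i j * cc (kap M i j) (2 * n + 2)
      - cc (kap M i j) (2 * n + 1) := rfl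
    rw [e1, e2, f1, f2]
    simp only [map_neg, map_add, map_smul, sr_apply, phi_single, kap_self, kap_comm M j i]
    module

theorem liftable : M.IsLiftable (sr M) := by
  intro i j
  by_cases hij : i = j
  · subst hij; simp [sr_sq]
  by_cases h0 : M i j = 0
  · simp [h0]
  have h1 : M i j ≠ 1 := M.off_diagonal i j hij
  obtain ⟨m, hm⟩ : ∃ m, M i j = m + 1 := ⟨M i j - 1, by omega⟩
  set θ := Real.pi / M i j with hθ
  have h2 : (2 : ℝ) ≤ M i j := by exact_mod_cast (by omega : 2 ≤ M i j)
  have hs : 0 < Real.sin θ := by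
      apply Real.sin_pos_of_pos_of_lt_pi (by positivity)
      rw [div_lt_iff₀ (by positivity)]
      nlinarith [Real.pi_pos]
  have hk : kap M i j = 2 * Real.cos θ := rfl
  have hmt : (M i j : ℝ) * θ = Real.pi := by rw [hθ]; field_simp
  have c0 : cc (kap M i j) (2 * M i j) = 0 := by
    have := cc_sin θ (2 * M i j)
    have e : ((2 * M i j : ℕ) : ℝ) * θ = 2 * Real.pi := by push_cast; linarith
    rw [e, Real.sin_two_pi, ← hk] at this
    simpa [hs.ne'] using this
  have c1 : cc (kap M i j) (2 * M i j + 1) = 1 := by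
    have := cc_sin θ (2 * M i j + 1)
    have e : ((2 * M i j + 1 : ℕ) : ℝ) * θ = θ + 2 * Real.pi := by push_cast; linarith
    rw [e, Real.sin_add_two_pi, ← hk] at this
    exact mul_right_cancel₀ hs.ne' (by rw [this, one_mul])
  have c2 : cc (kap M i j) (2 * m + 1) = -1 := by
    have e : 2 * M i j + 1 = 2 * m + 1 + 2 := by rw [hm]; ring
    have e' : 2 * M i j = 2 * m + 1 + 1 := by rw [hm]; ring
    rw [e, cc, ← e', c0] at c1
    linarith
  have fs : ((sr M i * sr M j) ^ (M i j)) (Finsupp.single i 1) = Finsupp.single i 1 := by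
    rw [pow_s, c0, c1]; module
  have ft : ((sr M i * sr M j) ^ (M i j)) (Finsupp.single j 1) = Finsupp.single j 1 := by
    have := pow_t M i j m
    have e' : 2 * m + 2 = 2 * M i j := by rw [hm]; ring
    rw [e', c0, c2, ← hm] at this
    rw [this]; module
  apply LinearMap.ext
  intro v
  set κ := kap M i j with hκ
  have hd : 4 - κ^2 ≠ 0 := by
    have := Real.sin_sq_add_cos_sq θ
    have h3 : 4 - κ^2 = 4 * Real.sin θ ^2 := by rw [hk]; nlinarith
    rw [h3]; positivity
  set p := phi M i v with hp
  set q := phi M j v with hq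
  -- v - x αi - y αj orthogonal
  set x := -(2 * p + κ * q) / (4 - κ^2) with hx
  set y := -(2 * q + κ * p) / (4 - κ^2) with hy
  set u := v - x • Finsupp.single i (1:ℝ) - y • Finsupp.single j (1:ℝ) with hu
  have ui : phi M i u = 0 := by
    simp only [hu, map_sub, map_smul, phi_single, kap_self, smul_eq_mul, ← hp, ← hκ]
    rw [hx, hy]; field_simp; ring
  have uj : phi M j u = 0 := by
    simp only [hu, map_sub, map_smul, phi_single, kap_self, smul_eq_mul, ← hq, kap_comm M j i, ← hκ]
    rw [hx, hy]; field_simp; ring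
  have fu : ∀ n, ((sr M i * sr M j) ^ n) u = u := by
    intro n
    induction n with
    | zero => simp
    | succ n ih => rw [pow_succ', Module.End.mul_apply, ih, Module.End.mul_apply, sr_apply M j, uj, zero_smul, add_zero, sr_apply, ui]; simp
  have hv : v = u + x • Finsupp.single i (1:ℝ) + y • Finsupp.single j (1:ℝ) := by rw [hu]; module
  rw [hv, map_add, map_add, map_smul, map_smul, fs, ft, fu]; rfl

variable {M} {W : Type*} [Group W] (cs : CoxeterSystem M W)

noncomputable def rep : W →* Module.End ℝ (B →₀ ℝ) := cs.lift ⟨sr M, liftable M⟩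

theorem rep_simple (i : B) : rep cs (cs.simple i) = sr M i := by
  simp [rep]

theorem rep_alt (i j : B) (n : ℕ) :
    rep cs (cs.wordProd (alternatingWord i j n)) (Finsupp.single i 1) =
    if Even n then cc (kap M i j) (n+1) • Finsupp.single i 1 + cc (kap M i j) n • Finsupp.single j 1
    else cc (kap M i j) (n+1) • Finsupp.single j 1 + cc (kap M i j) n • Finsupp.single i 1 := by
  induction n with
  | zero => simp [cc, alternatingWord]
  | succ n ih =>
    rw [alternatingWord_succ', cs.wordProd_cons, map_mul, Module.End.mul_apply, ih, rep_simple]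
    by_cases h : Even n
    · have h' : ¬ Even (n+1) := by simpa [Nat.even_add_one] using h
      simp only [h, h', if_true, if_false]
      rw [cc]
      simp only [map_add, map_smul, sr_apply, phi_single, kap_self, kap_comm M j i]
      module
    · have h' : Even (n+1) := by simpa [Nat.even_add_one] using h
      simp only [h, h', if_true, if_false]
      rw [cc]
      simp only [map_add, map_smul, sr_apply, phi_single, kap_self, kap_comm M j i]
      module

theorem rep_pos (w : W) (i : B) (h : cs.length w < cs.length (w * cs.simple i)) :
    0 ≤ rep cs w (Finsupp.single i 1) := by
  induction hn : cs.length w using Nat.strong_induction_on generalizing w i with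
  | _ n ih =>
  subst hn
  by_cases hw : w = 1
  · subst hw; simp
  obtain ⟨j, hj⟩ := cs.exists_rightDescent_of_ne_one hw
  have hij : i ≠ j := by
    rintro rfl
    unfold CoxeterSystem.IsRightDescent at hj; omega
  classical
  let Q : ℕ → Prop := fun q => ∃ v, w = v * cs.wordProd (alternatingWord i j q) ∧
    cs.length w = cs.length v + q
  have hex : ∃ q, ¬ Q q := ⟨cs.length w + 1, by rintro ⟨v, -, h⟩; omega⟩
  have hQ1 : Q 1 := by
    refine ⟨w * cs.simple j, ?_, ?_⟩
    · simp [alternatingWord]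
    · have := cs.isRightDescent_iff.1 hj; omega
  have hQ0 : Q 0 := ⟨w, by simp [alternatingWord], by simp⟩
  obtain ⟨q, hq⟩ : ∃ q, Nat.find hex = q + 1 := by
    refine ⟨Nat.find hex - 1, ?_⟩
    have : Nat.find hex ≠ 0 := by intro h; exact Nat.find_spec hex (h ▸ hQ0)
    omega
  have hnot : ¬ Q (q+1) := hq ▸ Nat.find_spec hex
  have hall : ∀ r ≤ q, Q r := fun r hr => by
    by_contra hc; have := Nat.find_min' hex hc; omega
  have hq1 : 1 ≤ q := by
    by_contra hc; have : q = 0 := by omega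
    subst this; exact hnot hQ1
  have hm : M i j ≠ 0 → q + 1 ≤ M i j := by
    intro h0
    by_contra hc
    obtain ⟨v, hv, hl⟩ := hall (M i j) (by omega)
    have hb := cs.wordProd_braidWord_eq i j
    unfold braidWord at hb
    rw [hb, M.symmetric j i] at hv
    obtain ⟨m, hm⟩ : ∃ m, M i j = m + 1 := ⟨M i j - 1, by omega⟩
    rw [hm, alternatingWord_succ, List.concat_eq_append, cs.wordProd_append] at hv
    have h2 : w * cs.simple i = v * cs.wordProd (alternatingWord i j m) := by
      rw [hv]; simp [mul_assoc]
    have h3 := cs.length_mul_le v (cs.wordProd (alternatingWord i j m))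
    have h4 := cs.length_wordProd_le (alternatingWord i j m)
    rw [length_alternatingWord] at h4
    rw [h2] at h
    omega
  obtain ⟨v, hv, hl⟩ := hall q le_rfl
  -- prepending letter
  have hy : ∀ y, y = (if Even q then j else i) → cs.length v < cs.length (v * cs.simple y) := by
    intro y hy
    by_contra hc
    apply hnot
    have h5 := cs.length_mul_simple v y
    refine ⟨v * cs.simple y, ?_, by omega⟩
    rw [alternatingWord_succ', ← hy, cs.wordProd_cons, hv]; simp [mul_assoc]
  have hx : ∀ x, x = (if Even q then i else j) → cs.length v < cs.length (v * cs.simple x) := by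
    intro x hx
    by_contra hc
    have h5 := cs.length_mul_simple v x
    obtain ⟨r, rfl⟩ : ∃ r, q = r + 1 := ⟨q - 1, by omega⟩
    have hx' : x = if Even r then j else i := by
      rw [hx]; by_cases hr : Even r <;> simp [hr, Nat.even_add_one]
    rw [alternatingWord_succ', ← hx', cs.wordProd_cons, ← mul_assoc] at hv
    have h3 := cs.length_mul_le (v * cs.simple x) (cs.wordProd (alternatingWord i j r))
    have h4 := cs.length_wordProd_le (alternatingWord i j r)
    rw [length_alternatingWord] at h4
    rw [← hv] at h3
    omega
  have py := ih _ (by omega) v _ (hy _ rfl) rfl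
  have px := ih _ (by omega) v _ (hx _ rfl) rfl
  have c1 := cc_nonneg M i j hij (q+1) hm
  have c2 := cc_nonneg M i j hij q (fun h => by have := hm h; omega)
  rw [hv, map_mul, Module.End.mul_apply, rep_alt]
  by_cases he : Even q
  · simp only [he, if_true] at px py ⊢
    rw [map_add, map_smul, map_smul]
    exact add_nonneg (smul_nonneg c1 px) (smul_nonneg c2 py)
  · simp only [he, if_false] at px py ⊢
    rw [map_add, map_smul, map_smul]
    exact add_nonneg (smul_nonneg c1 px) (smul_nonneg c2 py)

theorem rep_inv_rep (w : W) (v : B →₀ ℝ) : rep cs w⁻¹ (rep cs w v) = v := by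
  rw [← Module.End.mul_apply, ← map_mul]; simp

theorem rep_rep_inv (w : W) (v : B →₀ ℝ) : rep cs w (rep cs w⁻¹ v) = v := by
  rw [← Module.End.mul_apply, ← map_mul]; simp

theorem rep_mul (w u : W) (v : B →₀ ℝ) : rep cs (w * u) v = rep cs w (rep cs u v) := by
  rw [map_mul, Module.End.mul_apply]

theorem rep_simple_self (i : B) : rep cs (cs.simple i) (Finsupp.single i 1) = - Finsupp.single i 1 := by
  rw [rep_simple, sr_self]

abbrev E (J : Set B) : Submodule ℝ (B →₀ ℝ) := Finsupp.supported ℝ ℝ J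

theorem mem_E {J : Set B} {y : B →₀ ℝ} : y ∈ E J ↔ ∀ x ∉ J, y x = 0 := Finsupp.mem_supported' _ _

theorem single_mem_E {J : Set B} {i : B} (h : i ∈ J) (r : ℝ) : Finsupp.single i r ∈ E J :=
  Finsupp.single_mem_supported ℝ r h

theorem E_mono {J K : Set B} (h : J ⊆ K) : E J ≤ E K := Finsupp.supported_mono h

theorem par_mem {J : Set B} {w : W} (hw : w ∈ parabolic cs J) (v : B →₀ ℝ) :
    rep cs w v - v ∈ E J := by
  unfold parabolic at hw
  induction hw using Subgroup.closure_induction generalizing v with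
  | mem x hx =>
    obtain ⟨i, hi, rfl⟩ := hx
    rw [rep_simple, sr_apply, add_sub_cancel_left]
    exact Submodule.smul_mem _ _ (single_mem_E hi 1)
  | one => simp
  | mul x y _ _ hx hy =>
    rw [rep_mul]
    have := add_mem (hx (rep cs y v)) (hy v)
    simpa using this
  | inv x _ hx =>
    have := neg_mem (hx (rep cs x⁻¹ v))
    rw [rep_rep_inv] at this
    simpa using this

theorem par_map {J : Set B} {w : W} (hw : w ∈ parabolic cs J) {v : B →₀ ℝ} (hv : v ∈ E J) :
    rep cs w v ∈ E J := by
  have := add_mem (par_mem cs hw v) hv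
  simpa using this

theorem par_fix {J : Set B} {w : W} (hw : w ∈ parabolic cs J) {k : B} (hk : ∀ j ∈ J, M j k = 2) :
    rep cs w (Finsupp.single k 1) = Finsupp.single k 1 := by
  unfold parabolic at hw
  induction hw using Subgroup.closure_induction with
  | mem x hx =>
    obtain ⟨i, hi, rfl⟩ := hx
    rw [rep_simple, sr_apply, phi_single, kap, hk i hi]
    simp
  | one => simp
  | mul x y _ _ hx hy => rw [rep_mul, hy, hx]
  | inv x _ hx =>
    conv_lhs => rw [← hx]
    rw [rep_inv_rep]

theorem rep_neg (w : W) (i : B) (h : cs.length (w * cs.simple i) < cs.length w) :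
    rep cs w (Finsupp.single i 1) ≤ 0 := by
  have := rep_pos cs (w * cs.simple i) i (by simpa using h)
  rw [rep_mul, rep_simple_self, map_neg] at this
  exact neg_nonneg.1 this

def IsRoot (β : B →₀ ℝ) : Prop := ∃ w i, β = rep cs w (Finsupp.single i 1)

variable {cs} in
theorem IsRoot.dich {β : B →₀ ℝ} (h : IsRoot cs β) : 0 ≤ β ∨ β ≤ 0 := by
  obtain ⟨w, i, rfl⟩ := h
  rcases cs.length_mul_simple w i with h | h
  · exact .inl (rep_pos cs w i (by omega))
  · exact .inr (rep_neg cs w i (by omega))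

variable {cs} in
theorem IsRoot.ne_zero {β : B →₀ ℝ} (h : IsRoot cs β) : β ≠ 0 := by
  obtain ⟨w, i, rfl⟩ := h
  intro h0
  have := rep_inv_rep cs w (Finsupp.single i 1)
  rw [h0, map_zero] at this
  have := DFunLike.congr_fun this i
  simp at this

variable {cs} in
theorem IsRoot.map {β : B →₀ ℝ} (h : IsRoot cs β) (u : W) : IsRoot cs (rep cs u β) := by
  obtain ⟨w, i, rfl⟩ := h
  exact ⟨u * w, i, by rw [rep_mul]⟩

theorem isRoot_single (i : B) : IsRoot cs (Finsupp.single i 1) := ⟨1, i, by simp⟩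

theorem descent_of_neg {w : W} {i c : B} (h : rep cs w (Finsupp.single i 1) c < 0) :
    cs.length (w * cs.simple i) < cs.length w := by
  rcases cs.length_mul_simple w i with h' | h'
  · have := rep_pos cs w i (by omega) c
    simp at this; linarith
  · omega

theorem descent_mem {J : Set B} {w : W} (hw : w ∈ parabolic cs J) {k : B}
    (h : cs.length (w * cs.simple k) < cs.length w) : k ∈ J := by
  by_contra hk
  have h1 := rep_neg cs w k h k
  have h2 := mem_E.1 (par_mem cs hw (Finsupp.single k 1)) k hk
  simp at h1 h2
  linarith

theorem neg_map {K : Set B} {w : W} (h : ∀ k ∈ K, rep cs w (Finsupp.single k 1) ≤ 0)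
    {y : B →₀ ℝ} (hy : y ∈ E K) (h0 : 0 ≤ y) : rep cs w y ≤ 0 := by
  have e : y = y.sum (fun j r => r • Finsupp.single j 1) := by
    conv_lhs => rw [← Finsupp.sum_single y]
    simp
  rw [e, map_finsuppSum]
  apply Finset.sum_nonpos
  intro j hj
  dsimp only
  rw [map_smul]
  have hjK : j ∈ K := by
    by_contra hc
    exact (Finsupp.mem_support_iff.1 hj) (mem_E.1 hy j hc)
  exact smul_nonpos_of_nonneg_of_nonpos (h0 j) (h j hjK)

theorem longest_neg {K : Set B} {w : W} (hw : w ∈ parabolic cs K)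
    (hmax : ∀ u ∈ parabolic cs K, cs.length u ≤ cs.length w) {k : B} (hk : k ∈ K) :
    rep cs w (Finsupp.single k 1) ≤ 0 := by
  apply rep_neg
  have h1 := hmax (w * cs.simple k) (mul_mem hw (Subgroup.subset_closure ⟨k, hk, rfl⟩))
  have h2 := cs.length_mul_simple_ne w k
  omega

theorem longest_sq {K : Set B} {w : W} (hw : w ∈ parabolic cs K)
    (hmax : ∀ u ∈ parabolic cs K, cs.length u ≤ cs.length w) : w * w = 1 := by
  by_contra hne
  obtain ⟨k, hk⟩ := cs.exists_rightDescent_of_ne_one hne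
  have hkK := descent_mem cs (mul_mem hw hw) hk
  have h1 := rep_neg cs _ k hk
  have h2 := neg_map cs (fun k hk => longest_neg cs hw hmax hk)
    (neg_mem (par_map cs hw (single_mem_E hkK 1))) (neg_nonneg.2 (longest_neg cs hw hmax hkK))
  rw [map_neg, ← rep_mul] at h2
  exact ((isRoot_single cs k).map (w * w)).ne_zero (le_antisymm h1 (neg_nonpos.1 h2))

/-- data extracted from a Brink-Howlett generator -/
structure Gen (I : Set B) (a : B) (v : W) (I' : Set B) (c : B) : Prop where
  ha : a ∉ I
  hc : c ∈ insert a I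
  hv : v ∈ parabolic cs (insert a I)
  hI' : I' = insert a I \ {c}
  h1 : ∀ y ∈ E I, rep cs v⁻¹ y ∈ E I'
  h2 : rep cs v⁻¹ (Finsupp.single a 1) c < 0

theorem parabolic_mono {J K : Set B} (h : J ⊆ K) : parabolic cs J ≤ parabolic cs K :=
  Subgroup.closure_mono (Set.image_mono h)

theorem compOf_subset (I : Set B) (a : B) : compOf M I a ⊆ insert a I := by
  intro b hb
  have hb : Relation.ReflTransGen _ a b := hb
  rcases Relation.ReflTransGen.cases_tail hb with h | ⟨c, -, h⟩
  · rw [h]; exact Set.mem_insert _ _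
  · exact h.2.1

theorem mem_compOf (I : Set B) (a : B) : a ∈ compOf M I a := Relation.ReflTransGen.refl

theorem comp_orth {I : Set B} {a k j : B} (hk : k ∈ I) (hk' : k ∉ compOf M I a)
    (hj : j ∈ compOf M I a) : M j k = 2 := by
  by_contra h
  apply hk'
  exact Relation.ReflTransGen.tail hj ⟨compOf_subset I a hj, Set.mem_insert_of_mem _ hk, h⟩

theorem E_of_basis {I J : Set B} {f : Module.End ℝ (B →₀ ℝ)}
    (h : ∀ k ∈ I, f (Finsupp.single k 1) ∈ E J) {y : B →₀ ℝ} (hy : y ∈ E I) : f y ∈ E J := by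
  rw [E, Finsupp.supported_eq_span_single] at hy
  have : Submodule.span ℝ ((fun i => Finsupp.single i (1:ℝ)) '' I) ≤ (E J).comap f := by
    rw [Submodule.span_le]
    rintro _ ⟨k, hk, rfl⟩
    exact h k hk
  exact this hy

theorem gen_of {I : Set B} {a c : B} (ha : a ∉ I) {wK u : W}
    (hwK : wK ∈ parabolic cs (compOf M I a))
    (hmax : ∀ u ∈ parabolic cs (compOf M I a), cs.length u ≤ cs.length wK)
    (hu : u ∈ parabolic cs (compOf M I a \ {a}))
    (hc : wK * cs.simple a * wK⁻¹ = cs.simple c) :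
    Gen cs I a (u * wK) (insert a I \ {c}) c := by
  set K := compOf M I a with hK
  have haK : a ∈ K := mem_compOf I a
  have hKI : K ⊆ insert a I := compOf_subset I a
  have hsq := longest_sq cs hwK hmax
  have hinv : wK⁻¹ = wK := inv_eq_of_mul_eq_one_left hsq
  have hcK : c ∈ K := by
    apply descent_mem cs (w := cs.simple c)
    · rw [← hc]
      exact mul_mem (mul_mem hwK (Subgroup.subset_closure ⟨a, haK, rfl⟩)) (inv_mem hwK)
    · simp
  have huK : u ∈ parabolic cs K := parabolic_mono cs Set.diff_subset hu
  -- wK α_a = p α_c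
  obtain ⟨p, hp⟩ : ∃ p : ℝ, rep cs wK (Finsupp.single a 1) = p • Finsupp.single c 1 := by
    have e : rep cs (cs.simple c) (rep cs wK (Finsupp.single a 1))
        = - rep cs wK (Finsupp.single a 1) := by
      rw [← hc, rep_mul, rep_inv_rep, rep_mul, rep_simple_self, map_neg]
    rw [rep_simple, sr_apply] at e
    set z := rep cs wK (Finsupp.single a 1)
    refine ⟨-(phi M c z)/2, ?_⟩
    have : (2:ℝ) • z = (-(phi M c z)) • Finsupp.single c 1 := by
      rw [neg_smul, ← sub_eq_zero]
      have : z + phi M c z • Finsupp.single c 1 + z = 0 := by rw [e]; simp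
      rw [← this]; module
    have h' : z = (1/2 : ℝ) • ((2:ℝ) • z) := by module
    calc z = (1/2 : ℝ) • ((2:ℝ) • z) := h'
      _ = _ := by rw [this]; module
  have hp0 : p ≤ 0 := by
    have := longest_neg cs hwK hmax haK c
    rw [hp] at this; simpa using this
  have hpn : p < 0 := by
    refine lt_of_le_of_ne hp0 ?_
    rintro rfl
    exact ((isRoot_single cs a).map wK).ne_zero (by rw [hp]; simp)
  -- wK α_c = p⁻¹ α_a
  have hpc : rep cs wK (Finsupp.single c 1) = p⁻¹ • Finsupp.single a 1 := by
    have : p • rep cs wK (Finsupp.single c 1) = Finsupp.single a 1 := by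
      rw [← map_smul, ← hp, ← rep_mul, hsq]; simp
    rw [← this, smul_smul, inv_mul_cancel₀ hpn.ne, one_smul]
  have key : ∀ k ∈ K \ {a}, rep cs wK (Finsupp.single k 1) ∈ E (K \ {c}) := by
    rintro k ⟨hkK, hka⟩
    have hmem := par_map cs hwK (single_mem_E hkK 1)
    have hneg := longest_neg cs hwK hmax hkK
    set z := rep cs wK (Finsupp.single k 1) with hz
    have hzc : z c = 0 := by
      -- -z = (-z c) α_c + z', z' ≥ 0
      set z' := -z - (-z c) • Finsupp.single c (1:ℝ) with hz'
      have h1 : 0 ≤ z' := by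
        intro x
        by_cases hx : x = c
        · subst hx; simp [hz']
        · have := hneg x
          simp [hz', Finsupp.single_apply, Ne.symm hx]
          simpa using this
      have h2 : z' ∈ E K := sub_mem (neg_mem hmem) (Submodule.smul_mem _ _ (single_mem_E hcK 1))
      have h3 := neg_map cs (fun k hk => longest_neg cs hwK hmax hk) h2 h1 a
      rw [hz', map_sub, map_neg, map_smul, hpc, hz, ← rep_mul, hsq, ← hz] at h3
      have hka' : k ≠ a := hka
      simp [Finsupp.single_apply, hka'] at h3
      have h4 := hneg c
      simp at h4
      have h5 : p⁻¹ < 0 := inv_lt_zero.2 hpn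
      nlinarith
    rw [mem_E] at hmem ⊢
    intro x hx
    by_cases hxc : x = c
    · rw [hxc, hzc]
    · exact hmem x (fun h => hx ⟨h, hxc⟩)
  have hKc : K \ {c} ⊆ insert a I \ {c} := Set.diff_subset_diff_left hKI
  refine ⟨ha, hKI hcK, parabolic_mono cs hKI (mul_mem huK hwK), rfl, ?_, ?_⟩
  · intro y hy
    refine E_of_basis ?_ hy
    intro k hk
    have hka : k ≠ a := fun h => ha (h ▸ hk)
    by_cases hkK : k ∈ K
    · rw [mul_inv_rev, hinv, rep_mul]
      apply E_mono hKc
      exact E_of_basis key (par_map cs (inv_mem hu) (single_mem_E (J := K \ {a}) ⟨hkK, hka⟩ 1))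
    · rw [par_fix cs (inv_mem (mul_mem huK hwK)) (fun j hj => comp_orth hk hkK hj)]
      have hkc : k ≠ c := fun h => hkK (h ▸ hcK)
      exact single_mem_E (J := insert a I \ {c}) ⟨Set.mem_insert_of_mem _ hk, hkc⟩ 1
  · rw [mul_inv_rev, hinv, rep_mul]
    have h1 := E_of_basis key (par_mem cs (inv_mem hu) (Finsupp.single a 1))
    rw [map_sub, hp, mem_E] at h1
    have h2 := h1 c (by simp)
    simp at h2
    linarith

theorem no_common (v w : W) (h : cs.length (v * w) = cs.length v + cs.length w)
    {γ : B →₀ ℝ} (hr : IsRoot cs γ) (h0 : 0 ≤ γ) (hv : rep cs v γ ≤ 0)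
    (hw : rep cs w⁻¹ γ ≤ 0) : False := by
  induction hn : cs.length w generalizing v w γ with
  | zero =>
    rw [cs.length_eq_zero_iff] at hn
    subst hn
    simp at hw
    exact hr.ne_zero (le_antisymm hw h0)
  | succ n ih =>
    have hne : w ≠ 1 := by rintro rfl; simp at hn
    obtain ⟨s, hs⟩ := cs.exists_leftDescent_of_ne_one hne
    have hs' := cs.isLeftDescent_iff.1 hs
    have hvs : v * w = (v * cs.simple s) * (cs.simple s * w) := by simp [mul_assoc]
    have e1 := cs.length_mul_le (v * cs.simple s) (cs.simple s * w)
    rw [← hvs] at e1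
    have e2 := cs.length_mul_simple v s
    have e3 : cs.length (v * cs.simple s) = cs.length v + 1 := by omega
    have hss : ∀ x, rep cs (cs.simple s) (rep cs (cs.simple s) x) = x := fun x => by
      rw [← rep_mul]; simp
    rcases (hr.map (cs.simple s)).dich with hd | hd
    · refine ih (v * cs.simple s) (cs.simple s * w) (by rw [← hvs]; omega)
        (hr.map (cs.simple s)) hd ?_ ?_ (by omega)
      · rw [rep_mul, hss]; exact hv
      · rw [mul_inv_rev, cs.inv_simple, rep_mul, hss]; exact hw
    · -- γ is a multiple of α_s
      have hγ : γ = γ s • Finsupp.single s 1 := by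
        ext x
        by_cases hx : x = s
        · subst hx; simp
        · have h1 := hd x
          rw [rep_simple, sr_apply] at h1
          have h2 := h0 x
          simp [Finsupp.single_apply, Ne.symm hx] at h1 h2 ⊢
          linarith
      have hpos : 0 ≤ rep cs v (Finsupp.single s 1) := rep_pos cs v s (by omega)
      have : 0 ≤ rep cs v γ := by
        rw [hγ, map_smul]; exact smul_nonneg (h0 s) hpos
      exact (hr.map v).ne_zero (le_antisymm hv this)

def Lam (I : Set B) (w : W) : Set (Submodule ℝ (B →₀ ℝ)) :=
  {U | ∃ β, IsRoot cs β ∧ 0 ≤ β ∧ rep cs w⁻¹ β ≤ 0 ∧ β ∉ E I ∧ U = E I ⊔ Submodule.span ℝ {β}}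

theorem Lam_one (I : Set B) : Lam cs I 1 = ∅ := by
  ext U
  simp only [Lam, Set.mem_setOf_eq, Set.mem_empty_iff_false, iff_false]
  rintro ⟨β, hr, h0, h1, -⟩
  simp at h1
  exact hr.ne_zero (le_antisymm h1 h0)

theorem sub_mem_E {I : Set B} {a : B} {y β : B →₀ ℝ} (hy : y ∈ E (insert a I))
    (hβ : β ∈ E (insert a I)) (h : y a = β a) : y - β ∈ E I := by
  rw [mem_E] at *
  intro x hx
  by_cases hxa : x = a
  · subst hxa; simp [h]
  · have : x ∉ insert a I := by simp [hxa, hx]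
    simp [hy x this, hβ x this]

theorem sup_eq {I : Set B} {a : B} {β : B →₀ ℝ} (hβ : β ∈ E (insert a I)) (hn : β ∉ E I) :
    E I ⊔ Submodule.span ℝ {β} = E (insert a I) := by
  apply le_antisymm
  · refine sup_le (E_mono (Set.subset_insert _ _)) ?_
    rw [Submodule.span_singleton_le_iff_mem]; exact hβ
  · intro y hy
    have h0 : β a ≠ 0 := by
      intro h
      apply hn
      simpa using sub_mem_E hβ (zero_mem _) (by simpa using h)
    have : y - (y a / β a) • β ∈ E I :=
      sub_mem_E hy (Submodule.smul_mem _ _ hβ) (by simp [h0])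
    have := Submodule.add_mem_sup this
      (Submodule.smul_mem _ (y a / β a) (Submodule.mem_span_singleton_self (R := ℝ) β))
    simpa using this

variable {cs} in
theorem Gen.coef {I I' : Set B} {a c : B} {v : W} (g : Gen cs I a v I' c) {y : B →₀ ℝ}
    (hy : y ∈ E (insert a I)) :
    rep cs v⁻¹ y c = y a * rep cs v⁻¹ (Finsupp.single a 1) c := by
  have h := g.h1 _ (sub_mem_E hy
    (Submodule.smul_mem _ (y a) (single_mem_E (Set.mem_insert a I) 1)) (by simp))
  rw [map_sub, map_smul, mem_E] at h
  have := h c (by rw [g.hI']; simp)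
  simp at this
  linarith

variable {cs} in
theorem Gen.mem_iff {I I' : Set B} {a c : B} {v : W} (g : Gen cs I a v I' c) (x : B →₀ ℝ) :
    rep cs v x ∈ E I ↔ x ∈ E I' := by
  constructor
  · intro h; have := g.h1 _ h; rwa [rep_inv_rep] at this
  · intro h
    have hx : x ∈ E (insert a I) := E_mono (by rw [g.hI']; exact Set.diff_subset) h
    have hy := par_map cs g.hv hx
    have h3 := g.coef hy
    rw [rep_inv_rep, mem_E.1 h c (by rw [g.hI']; simp)] at h3
    have : rep cs v x a = 0 := by
      rcases mul_eq_zero.1 h3.symm with h | h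
      · exact h
      · exact absurd h g.h2.ne
    simpa using sub_mem_E hy (zero_mem _) (by simpa using this)

variable {cs} in
theorem Gen.map_E {I I' : Set B} {a c : B} {v : W} (g : Gen cs I a v I' c) :
    (E I').map (rep cs v) = E I := by
  ext y
  constructor
  · rintro ⟨x, hx, rfl⟩; exact (g.mem_iff x).2 hx
  · intro hy
    refine ⟨rep cs v⁻¹ y, g.h1 _ hy, rep_rep_inv cs v y⟩

variable {cs} in
theorem Gen.map_sup {I I' : Set B} {a c : B} {v : W} (g : Gen cs I a v I' c) (γ : B →₀ ℝ) :
    (E I' ⊔ Submodule.span ℝ {γ}).map (rep cs v) = E I ⊔ Submodule.span ℝ {rep cs v γ} := by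
  rw [Submodule.map_sup, g.map_E, Submodule.map_span, Set.image_singleton]

variable {cs} in
theorem Gen.step {I I' : Set B} {a c : B} {v : W} (g : Gen cs I a v I' c) {w : W}
    (h : cs.length (v * w) = cs.length v + cs.length w) :
    Lam cs I (v * w) = insert (E (insert a I)) ((Submodule.map (rep cs v)) '' Lam cs I' w) ∧
    E (insert a I) ∉ (Submodule.map (rep cs v)) '' Lam cs I' w := by
  refine ⟨?_, ?_⟩
  · ext U
    constructor
    · rintro ⟨β, hr, h0, hn, hI, rfl⟩
      rcases (hr.map v⁻¹).dich with hd | hd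
      · right
        refine ⟨_, ⟨rep cs v⁻¹ β, hr.map _, hd, ?_, ?_, rfl⟩, ?_⟩
        · rw [← rep_mul, ← mul_inv_rev]; exact hn
        · rw [← g.mem_iff, rep_rep_inv]; exact hI
        · rw [g.map_sup, rep_rep_inv]
      · left
        refine sup_eq ?_ hI
        rw [mem_E]
        intro x hx
        have h1 := mem_E.1 (par_mem cs (inv_mem g.hv) β) x hx
        have h2 := hd x
        have h3 := h0 x
        simp at h1 h2 h3
        linarith
    · rintro (rfl | ⟨_, ⟨γ, hr, h0, hn, hI, rfl⟩, rfl⟩)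
      · have hnm : Finsupp.single a (1:ℝ) ∉ E I := by
          intro hm
          have := mem_E.1 hm a g.ha
          simp at this
        refine ⟨Finsupp.single a 1, isRoot_single cs a, ?_, ?_, hnm, ?_⟩
        · simp
        · apply rep_neg
          have h1 := descent_of_neg cs g.h2
          have e1 : v⁻¹ * cs.simple a = (cs.simple a * v)⁻¹ := by simp
          have e2 : (v * w)⁻¹ * cs.simple a = (cs.simple a * v * w)⁻¹ := by simp [mul_assoc]
          rw [e1, cs.length_inv, cs.length_inv] at h1
          rw [e2, cs.length_inv, cs.length_inv]
          have := cs.length_mul_le (cs.simple a * v) w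
          omega
        · exact (sup_eq (single_mem_E (Set.mem_insert a I) 1) hnm).symm
      · refine ⟨rep cs v γ, hr.map v, ?_, ?_, ?_, ?_⟩
        · rcases (hr.map v).dich with hd | hd
          · exact hd
          · exact (no_common cs v w h hr h0 hd hn).elim
        · rw [mul_inv_rev, rep_mul, rep_inv_rep]; exact hn
        · rw [g.mem_iff]; exact hI
        · rw [g.map_sup]
  · rintro ⟨_, ⟨γ, hr, h0, hn, hI, rfl⟩, heq⟩
    rw [g.map_sup] at heq
    have hm : rep cs v γ ∈ E (insert a I) := by
      rw [← heq]
      exact Submodule.mem_sup_right (Submodule.mem_span_singleton_self _)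
    have hpos : 0 ≤ rep cs v γ := by
      rcases (hr.map v).dich with hd | hd
      · exact hd
      · exact (no_common cs v w h hr h0 hd hn).elim
    have h3 := g.coef hm
    rw [rep_inv_rep] at h3
    have h4 := h0 c
    have h5 := hpos a
    have h6 := g.h2
    simp at h4 h5
    have h7 : rep cs v γ a = 0 := by
      by_contra hne
      have : 0 < rep cs v γ a := lt_of_le_of_ne h5 (Ne.symm hne)
      nlinarith
    apply hI
    rw [← g.mem_iff]
    simpa using sub_mem_E hm (zero_mem _) (by simpa using h7)

theorem map_inj (v : W) : Function.Injective (Submodule.map (rep cs v)) := by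
  apply Submodule.map_injective_of_injective
  intro x y hxy
  rw [← rep_inv_rep cs v x, hxy, rep_inv_rep]

theorem length_ofFn_le (m : ℕ) (v : Fin m → W) :
    cs.length (List.ofFn v).prod ≤ ∑ i, cs.length (v i) := by
  induction m with
  | zero => simp
  | succ m ih =>
    rw [List.ofFn_succ, List.prod_cons, Fin.sum_univ_succ]
    have := ih (fun i => v i.succ)
    have := cs.length_mul_le (v 0) (List.ofFn fun i => v i.succ).prod
    omega

theorem card_Lam (m : ℕ) (a : Fin m → B) (I : Fin (m+1) → Set B) (v : Fin m → W)
    (hg : ∀ i : Fin m, ∃ c, Gen cs (I i.castSucc) (a i) (v i) (I i.succ) c)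
    (hl : cs.length (List.ofFn v).prod = ∑ i, cs.length (v i)) :
    (Lam cs (I 0) (List.ofFn v).prod).encard = m := by
  induction m with
  | zero => simp [Lam_one]
  | succ m ih =>
    rw [List.ofFn_succ, List.prod_cons] at hl ⊢
    rw [Fin.sum_univ_succ] at hl
    have h1 := length_ofFn_le cs m (fun i => v i.succ)
    have h2 := cs.length_mul_le (v 0) (List.ofFn fun i => v i.succ).prod
    have ih' := ih (fun i => a i.succ) (fun i => I i.succ) (fun i => v i.succ)
      (fun i => hg i.succ) (by omega)
    obtain ⟨c, g⟩ := hg 0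
    obtain ⟨e1, e2⟩ := g.step (w := (List.ofFn fun i => v i.succ).prod) (by omega)
    have e0 : I (Fin.castSucc 0) = I 0 := rfl
    rw [e0] at e1 e2
    rw [e1, Set.encard_insert_of_notMem e2, (map_inj cs _).encard_image, ih']
    push_cast; rfl

end BH

/-- Any two standard expressions of the same element based at the same associate
have the same length. Here `wl` assigns to every subset generating a finite standard parabolic its
longest element, the Brink–Howlett generators are `v_{a,I} = w_{[I,a]−a} w_{[I,a]}`, the two
sequences of generators have matching sources/targets (`I (i+1) = I i + a_i − ι_{[I i, a_i]}(a_i)`,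
with `ι` given by conjugation by the longest element), both products are length-additive, the
products are equal, and `I 0 = L 0` is an associate of `J`; the conclusion is `m = n`. -/
theorem standard_expressions_same_length {B W : Type*} [Group W]
    {M : CoxeterMatrix B} (cs : CoxeterSystem M W) (J : Set B)
    (wl : Set B → W)
    (hwl : ∀ S : Set B, ((parabolic cs S : Set W)).Finite →
      wl S ∈ parabolic cs S ∧ ∀ u ∈ parabolic cs S, cs.length u ≤ cs.length (wl S))
    (m n : ℕ) (a : Fin m → B) (I : Fin (m + 1) → Set B)
    (b : Fin n → B) (L : Fin (n + 1) → Set B)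
    (hI0 : I 0 = L 0) (hassoc : IsAssociate cs J (I 0))
    (haI : ∀ i : Fin m, a i ∉ I i.castSucc)
    (hbL : ∀ i : Fin n, b i ∉ L i.castSucc)
    (hIfin : ∀ i : Fin m, ((parabolic cs (compOf M (I i.castSucc) (a i)) : Set W)).Finite)
    (hLfin : ∀ i : Fin n, ((parabolic cs (compOf M (L i.castSucc) (b i)) : Set W)).Finite)
    (hIstep : ∀ i : Fin m, ∃ c : B,
      wl (compOf M (I i.castSucc) (a i)) * cs.simple (a i) *
          (wl (compOf M (I i.castSucc) (a i)))⁻¹ = cs.simple c ∧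
      I i.succ = insert (a i) (I i.castSucc) \ {c})
    (hLstep : ∀ i : Fin n, ∃ c : B,
      wl (compOf M (L i.castSucc) (b i)) * cs.simple (b i) *
          (wl (compOf M (L i.castSucc) (b i)))⁻¹ = cs.simple c ∧
      L i.succ = insert (b i) (L i.castSucc) \ {c})
    -- the Brink--Howlett generators along the two sequences
    (vA : Fin m → W) (vB : Fin n → W)
    (hvA : ∀ i : Fin m, vA i =
      wl (compOf M (I i.castSucc) (a i) \ {a i}) * wl (compOf M (I i.castSucc) (a i)))
    (hvB : ∀ i : Fin n, vB i =
      wl (compOf M (L i.castSucc) (b i) \ {b i}) * wl (compOf M (L i.castSucc) (b i)))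
    -- the two products are equal and both are standard (length-additive) expressions
    (heq : (List.ofFn vA).prod = (List.ofFn vB).prod)
    (hlenA : cs.length (List.ofFn vA).prod = ∑ i : Fin m, cs.length (vA i))
    (hlenB : cs.length (List.ofFn vB).prod = ∑ i : Fin n, cs.length (vB i)) :
    m = n := by
  have key : ∀ (m : ℕ) (a : Fin m → B) (I : Fin (m + 1) → Set B)
      (haI : ∀ i : Fin m, a i ∉ I i.castSucc)
      (hIfin : ∀ i : Fin m, ((parabolic cs (compOf M (I i.castSucc) (a i)) : Set W)).Finite)
      (hIstep : ∀ i : Fin m, ∃ c : B,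
        wl (compOf M (I i.castSucc) (a i)) * cs.simple (a i) *
          (wl (compOf M (I i.castSucc) (a i)))⁻¹ = cs.simple c ∧
        I i.succ = insert (a i) (I i.castSucc) \ {c})
      (vA : Fin m → W)
      (hvA : ∀ i : Fin m, vA i =
        wl (compOf M (I i.castSucc) (a i) \ {a i}) * wl (compOf M (I i.castSucc) (a i)))
      (hlenA : cs.length (List.ofFn vA).prod = ∑ i : Fin m, cs.length (vA i)),
      (BH.Lam cs (I 0) (List.ofFn vA).prod).encard = m := by
    intro m a I haI hIfin hIstep vA hvA hlenA
    refine BH.card_Lam cs m a I vA (fun i => ?_) hlenA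
    obtain ⟨c, hc, hI⟩ := hIstep i
    obtain ⟨h1, h2⟩ := hwl _ (hIfin i)
    have h3 := (hwl (compOf M (I i.castSucc) (a i) \ {a i})
      ((hIfin i).subset (BH.parabolic_mono cs Set.diff_subset))).1
    refine ⟨c, ?_⟩
    rw [hvA i, hI]
    exact BH.gen_of cs (haI i) h1 h2 h3 hc
  have e1 := key m a I haI hIfin hIstep vA hvA hlenA
  have e2 := key n b L hbL hLfin hLstep vB hvB hlenB
  rw [hI0, heq, e2] at e1
  exact_mod_cast e1.symm
end
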